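/- For a symmetric n×n matrix X over a commutative ring, with indices 2 ≤ i < j ≤ n-1 and I = {i+1,...,j-1}, defining p_I = (-1)^⌊|I|/2⌋ · det(X restricted to rows and columns I) and a_{ij|I} = (-1)^⌈|I|/2⌉ · det(X with rows {i}∪I and columns {j}∪I), the identity a_{ij|I}² − p_I · p_{I∪{i,j}} − p_{I∪{i}} · p_{I∪{j}} = 0 holds. -/

import Mathlib

namespace Matrix

variable {R : Type*} [CommRing R]

theorem det_updateCol_single_one {n : Type*} [Fintype n] [DecidableEq n]
    (M : Matrix n n R) (i j : n) :
    (M.updateCol i (Pi.single j 1)).det = M.adjugate i j := by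
  rw [← cramer_apply, cramer_eq_adjugate_mulVec, mulVec_single_one, col_apply]

/-- The determinant of the identity matrix with two columns replaced. -/
theorem det_one_updateCol_updateCol {n : Type*} [Fintype n] [DecidableEq n]
    {p q : n} (hpq : p ≠ q) (u v : n → R) :
    (((1 : Matrix n n R).updateCol p u).updateCol q v).det = u p * v q - v p * u q := by
  have h : ((1 : Matrix n n R).updateCol p u).updateCol q v =
      1 + (of fun a (c : Fin 2) => ![u a - (1 : Matrix n n R) a p, v a - (1 : Matrix n n R) a q] c) *
        (of fun (c : Fin 2) b => ![(1 : Matrix n n R) p b, (1 : Matrix n n R) q b] c) := by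
    ext a b
    rw [add_apply, mul_apply, Fin.sum_univ_two]
    by_cases hq : b = q
    · subst hq
      simp [hpq]
    · by_cases hp : b = p
      · subst hp
        simp [updateCol_ne hpq, Ne.symm hpq]
      · simp [updateCol_ne hp, updateCol_ne hq, one_apply_ne (Ne.symm hp), one_apply_ne (Ne.symm hq)]
  rw [h, det_one_add_mul_comm, det_fin_two]
  simp [mul_apply, one_apply, hpq, Ne.symm hpq]

theorem det_updateCol_zero_updateCol_last {k : ℕ} (M : Matrix (Fin (k + 2)) (Fin (k + 2)) R) :
    ((M.updateCol 0 (Pi.single 0 1)).updateCol (Fin.last (k + 1))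
      (Pi.single (Fin.last (k + 1)) 1)).det =
    (M.submatrix (fun a : Fin k => a.succ.castSucc) (fun a : Fin k => a.succ.castSucc)).det := by
  have h : (M.updateCol 0 (Pi.single 0 1)).submatrix Fin.castSucc Fin.castSucc =
      (M.submatrix Fin.castSucc Fin.castSucc).updateCol 0 (Pi.single (0 : Fin (k + 1)) 1) := by
    ext a b
    by_cases hb : b = 0
    · subst hb
      simp [Pi.single_apply]
    · simp [hb]
  rw [det_updateCol_single_one, adjugate_fin_succ_eq_det_submatrix, Fin.succAbove_last, h,
    det_updateCol_single_one, adjugate_fin_succ_eq_det_submatrix, Fin.succAbove_zero]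
  simp [← two_mul, Function.comp_def]

/-- The Desnanot–Jacobi identity for adjugates, multiplied by the determinant. -/
theorem det_mul_adjugate_minor {k : ℕ} (M : Matrix (Fin (k + 2)) (Fin (k + 2)) R) :
    M.det * (M.adjugate 0 0 * M.adjugate (Fin.last _) (Fin.last _) -
      M.adjugate 0 (Fin.last _) * M.adjugate (Fin.last _) 0) =
    M.det * (M.det *
      (M.submatrix (fun a : Fin k => a.succ.castSucc) (fun a : Fin k => a.succ.castSucc)).det) := by
  have h0 : (0 : Fin (k + 2)) ≠ Fin.last (k + 1) := (Fin.last_pos).ne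
  have hcol (j : Fin (k + 2)) :
      M *ᵥ (fun a => M.adjugate a j) = M.det • (Pi.single j 1 : Fin (k + 2) → R) := by
    ext a
    have h := congrFun (congrFun M.mul_adjugate a) j
    simpa [mul_apply, mulVec, dotProduct, one_apply, Pi.single_apply] using h
  rw [← det_one_updateCol_updateCol h0 (fun a => M.adjugate a 0)
      (fun a => M.adjugate a (Fin.last _)), ← det_mul, mul_updateCol, mul_updateCol, mul_one,
    hcol, hcol, det_updateCol_smul, updateCol_comm _ h0, det_updateCol_smul,
    updateCol_comm _ h0.symm, det_updateCol_zero_updateCol_last]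

/-- The **Desnanot–Jacobi identity** (Dodgson condensation) for adjugate entries. -/
theorem adjugate_minor {k : ℕ} (M : Matrix (Fin (k + 2)) (Fin (k + 2)) R) :
    M.adjugate 0 0 * M.adjugate (Fin.last _) (Fin.last _) -
      M.adjugate 0 (Fin.last _) * M.adjugate (Fin.last _) 0 =
    M.det *
      (M.submatrix (fun a : Fin k => a.succ.castSucc) (fun a : Fin k => a.succ.castSucc)).det := by
  let f : MvPolynomial (Fin (k + 2) × Fin (k + 2)) ℤ →+* R :=
    MvPolynomial.eval₂Hom (Int.castRingHom R) fun p => M p.1 p.2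
  have hf : f.mapMatrix (mvPolynomialX (Fin (k + 2)) (Fin (k + 2)) ℤ) = M := by
    ext a b
    simp [f]
  have h := congrArg f (mul_left_cancel₀ (det_mvPolynomialX_ne_zero (Fin (k + 2)) ℤ)
    (det_mul_adjugate_minor (mvPolynomialX (Fin (k + 2)) (Fin (k + 2)) ℤ)))
  have hadj (a b : Fin (k + 2)) :
      f ((mvPolynomialX (Fin (k + 2)) (Fin (k + 2)) ℤ).adjugate a b) = M.adjugate a b := by
    rw [← hf, ← RingHom.map_adjugate]
    rfl
  rw [map_sub, map_mul, map_mul, map_mul, RingHom.map_det, RingHom.map_det, hf] at h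
  simp only [hadj] at h
  rw [h, ← hf]
  rfl

/-- The **Desnanot–Jacobi identity** (Dodgson condensation). -/
theorem det_mul_det_interior {k : ℕ} (M : Matrix (Fin (k + 2)) (Fin (k + 2)) R) :
    M.det *
      (M.submatrix (fun a : Fin k => a.succ.castSucc) (fun a : Fin k => a.succ.castSucc)).det =
    (M.submatrix Fin.succ Fin.succ).det * (M.submatrix Fin.castSucc Fin.castSucc).det -
      (M.submatrix Fin.castSucc Fin.succ).det * (M.submatrix Fin.succ Fin.castSucc).det := by
  have hs : ((-1 : R) ^ (k + 1)) * (-1) ^ (k + 1) = 1 := by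
    rw [← mul_pow]
    simp
  rw [← adjugate_minor]
  simp only [adjugate_fin_succ_eq_det_submatrix, Fin.succAbove_zero, Fin.succAbove_last,
    Fin.val_zero, Fin.val_last, add_zero, zero_add, pow_add _ (k + 1) (k + 1), hs, pow_zero]
  linear_combination
    -(M.submatrix Fin.castSucc Fin.succ).det * (M.submatrix Fin.succ Fin.castSucc).det * hs

end Matrix


/-- For a symmetric matrix `X` (entries given for all natural
indices, of which only the `n × n` block with indices `1,…,n` is relevant),
with `2 ≤ i < j ≤ n-1` and `I = {i+1,…,j-1}` of cardinality `k = j-i-1`, the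
signed principal minors `p_I, p_{I∪{i,j}}, p_{I∪{i}}, p_{I∪{j}}` and the signed
almost-principal minor `a_{ij|I}` satisfy
`a_{ij|I}² − p_I·p_{I∪{i,j}} − p_{I∪{i}}·p_{I∪{j}} = 0`. -/
theorem stmt0 {R : Type*} [CommRing R] (n i j : ℕ) (X : ℕ → ℕ → R)
    (hsym : ∀ a b, X a b = X b a)
    (h2 : 2 ≤ i) (hij : i < j) (hjn : j ≤ n - 1) :
    let k := j - i - 1
    -- rows and columns I = {i+1, …, j-1}
    let pI : R := (-1) ^ (k / 2) *
      Matrix.det (Matrix.of fun a b : Fin k => X (i + 1 + a) (i + 1 + b))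
    -- rows and columns I ∪ {i,j} = {i, …, j}
    let pIij : R := (-1) ^ ((k + 2) / 2) *
      Matrix.det (Matrix.of fun a b : Fin (k + 2) => X (i + a) (i + b))
    -- rows and columns I ∪ {i} = {i, …, j-1}
    let pIi : R := (-1) ^ ((k + 1) / 2) *
      Matrix.det (Matrix.of fun a b : Fin (k + 1) => X (i + a) (i + b))
    -- rows and columns I ∪ {j} = {i+1, …, j}
    let pIj : R := (-1) ^ ((k + 1) / 2) *
      Matrix.det (Matrix.of fun a b : Fin (k + 1) => X (i + 1 + a) (i + 1 + b))
    -- rows {i} ∪ I = {i, …, j-1}, columns {j} ∪ I = {i+1, …, j}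
    let aijI : R := (-1) ^ ((k + 1) / 2) *
      Matrix.det (Matrix.of fun a b : Fin (k + 1) => X (i + a) (i + 1 + b))
    aijI ^ 2 - pI * pIij - pIi * pIj = 0 := by
  intro k pI pIij pIi pIj aijI
  have hD := Matrix.det_mul_det_interior
    (Matrix.of fun a b : Fin (k + 2) => X (i + a) (i + b))
  have hadd {m : ℕ} (a : Fin m) : i + ((a : ℕ) + 1) = i + 1 + a := by omega
  have hsw : (Matrix.of fun a b : Fin (k + 2) => X (i + a) (i + b)).submatrix
      Fin.succ Fin.castSucc =
      (Matrix.of fun a b : Fin (k + 1) => X (i + a) (i + 1 + b)).transpose := by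
    ext a b
    simp [hadd, hsym (i + 1 + a)]
  rw [hsw, Matrix.det_transpose] at hD
  simp only [Matrix.submatrix, Matrix.of_apply, Fin.val_succ, Fin.val_castSucc, hadd] at hD
  have hsq : ((-1 : R) ^ (k / 2)) * (-1) ^ (k / 2) = 1 := by
    rw [← mul_pow]
    simp
  have hsq_succ : ((-1 : R) ^ ((k + 1) / 2)) * (-1) ^ ((k + 1) / 2) = 1 := by
    rw [← mul_pow]
    simp
  have hsign : (-1 : R) ^ ((k + 2) / 2) = -(-1) ^ (k / 2) := by
    rw [Nat.add_div_right k (by norm_num), pow_succ]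
    ring
  simp only [pI, pIij, pIi, pIj, aijI, hsign]
  set dI := Matrix.det (Matrix.of fun a b : Fin k => X (i + 1 + a) (i + 1 + b))
  set dIij := Matrix.det (Matrix.of fun a b : Fin (k + 2) => X (i + a) (i + b))
  set dIi := Matrix.det (Matrix.of fun a b : Fin (k + 1) => X (i + a) (i + b))
  set dIj := Matrix.det (Matrix.of fun a b : Fin (k + 1) => X (i + 1 + a) (i + 1 + b))
  set d := Matrix.det (Matrix.of fun a b : Fin (k + 1) => X (i + a) (i + 1 + b))
  linear_combination hD + dI * dIij * hsq + (d ^ 2 - dIi * dIj) * hsq_succ
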